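/- Let (E,ℒ,𝒜) be a weakly left-resolving, normal labelled space and S its inverse semigroup. A filter ξ^α in E(S) with complete family {ξ_n} is tight if and only if one of the following holds: (i) α is infinite and every nonempty member of the family {ξ_n}_{0≤n<∞} is an ultrafilter; (ii) α is finite, ξ_{|α|} is an ultrafilter in 𝒜^α, and for every A ∈ ξ_{|α|}, either ℒ(AE¹) is infinite or there exists B ∈ 𝒜^α with ∅ ≠ B ⊆ A ∩ E⁰_sink. -/

import Mathlib

open Classical

universe u v w

/-! ## Words over an alphabet -/

/-- Finite-or-infinite words over the alphabet `A`: `Sum.inl l` is the finite word `l`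
(with `[]` playing the role of the empty word `ω`), and `Sum.inr f` is the infinite word `f`. -/
abbrev Word (A : Type w) := List A ⊕ (ℕ → A)

/-- The length `|α| ∈ ℕ∞` of a word. -/
def wlength {A : Type w} : Word A → ℕ∞ :=
  Sum.elim (fun l => (l.length : ℕ∞)) fun _ => ⊤

/-- The finite prefix `α_{1,n}` of a word `α`. -/
def wprefix {A : Type w} : Word A → ℕ → List A :=
  Sum.elim (fun l n => l.take n) fun f n => List.ofFn fun i : Fin n => f i

/-- Concatenation `αβ` of a finite word `α` with a word `β`. -/
def wappend {A : Type w} (α : List A) : Word A → Word A :=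
  Sum.elim (fun l => Sum.inl (α ++ l)) fun f =>
    Sum.inr fun n => if h : n < α.length then α.get ⟨n, h⟩ else f (n - α.length)

/-- `β` is a beginning (finite prefix) of the word `α`. -/
def WPrefix {A : Type w} (β : List A) : Word A → Prop :=
  Sum.elim (fun l => β <+: l) fun f => β = List.ofFn fun i : Fin β.length => f i

/-! ## Triples -/

/-- Formal triples `(α, X, β)` together with a zero element; the inverse semigroup `S`
of a labelled space consists of such elements. -/
inductive Tr (V : Type u) (A : Type w) where
  | zero : Tr V A
  | mk : List A → Set V → List A → Tr V A

/-- The involution `(α,A,β)* = (β,A,α)` (fixing `0`). -/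
def Tr.tstar {V : Type u} {A : Type w} : Tr V A → Tr V A
  | .zero => .zero
  | .mk α X β => .mk β X α

/-! ## Labelled spaces -/

/-- The data of a labelled space `(E, ℒ, 𝒜)`: a directed graph on nonempty vertex/edge
sets, a surjective labelling map onto the alphabet `A`, and a family `𝒜` of subsets
of the vertex set. -/
structure LblSp (V : Type u) (E : Type v) (A : Type w) where
  src : E → V
  rng : E → V
  lab : E → A
  lab_surj : Function.Surjective lab
  nonempty_V : Nonempty V
  nonempty_E : Nonempty E
  𝒜 : Set (Set V)

namespace LblSp

variable {V : Type u} {Ed : Type v} {A : Type w} (Λ : LblSp V Ed A)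

/-- `α ≠ ω` is the label of some finite path of the graph. -/
def IsPathLabel (α : List A) : Prop :=
  ∃ l : List Ed, l ≠ [] ∧ List.Chain' (fun e f => Λ.rng e = Λ.src f) l ∧ l.map Λ.lab = α

/-- `ℒ^*`: the finite labelled paths, together with the empty word. -/
def LStar : Set (List A) := {α | α = [] ∨ Λ.IsPathLabel α}

/-- `ℒ^∞`: the infinite labelled paths. -/
def LInfty : Set (ℕ → A) :=
  {f | ∃ e : ℕ → Ed, (∀ n, Λ.rng (e n) = Λ.src (e (n + 1))) ∧ ∀ n, Λ.lab (e n) = f n}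

/-- `ℒ^{≤∞} = ℒ^* ∪ ℒ^∞`, as a predicate on `Word A`. -/
def IsWordW : Word A → Prop := Sum.elim (· ∈ Λ.LStar) (· ∈ Λ.LInfty)

/-- The relative range `r(X, α)` (with `r(X, ω) = X`). -/
noncomputable def relRange (X : Set V) (α : List A) : Set V :=
  if α = [] then X
  else {v | ∃ (l : List Ed) (h : l ≠ []), List.Chain' (fun e f => Λ.rng e = Λ.src f) l ∧
        l.map Λ.lab = α ∧ Λ.src (l.head h) ∈ X ∧ Λ.rng (l.getLast h) = v}

/-- The range `r(α) = r(E⁰, α)`. -/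
noncomputable def rangeL (α : List A) : Set V := Λ.relRange Set.univ α

/-- `𝒜^α = {X ∈ 𝒜 : X ⊆ r(α)}`. -/
noncomputable def Aset (α : List A) : Set (Set V) := {X | X ∈ Λ.𝒜 ∧ X ⊆ Λ.rangeL α}

/-- `(E, ℒ, 𝒜)` is a labelled space: `𝒜` is closed under finite intersections and
unions, contains all ranges `r(α)` for `α ∈ ℒ^{≥1}`, and is closed under relative ranges. -/
structure IsLS : Prop where
  inter_mem : ∀ X ∈ Λ.𝒜, ∀ Y ∈ Λ.𝒜, X ∩ Y ∈ Λ.𝒜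
  union_mem : ∀ X ∈ Λ.𝒜, ∀ Y ∈ Λ.𝒜, X ∪ Y ∈ Λ.𝒜
  range_mem : ∀ α ∈ Λ.LStar, α ≠ [] → Λ.rangeL α ∈ Λ.𝒜
  relRange_mem : ∀ X ∈ Λ.𝒜, ∀ α ∈ Λ.LStar, Λ.relRange X α ∈ Λ.𝒜

/-- A weakly left-resolving labelled space. -/
structure IsWLR : Prop where
  toIsLS : Λ.IsLS
  wlr : ∀ X ∈ Λ.𝒜, ∀ Y ∈ Λ.𝒜, ∀ α ∈ Λ.LStar, α ≠ [] →
    Λ.relRange (X ∩ Y) α = Λ.relRange X α ∩ Λ.relRange Y α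

/-- A weakly left-resolving normal labelled space. -/
structure IsNormal : Prop where
  toIsWLR : Λ.IsWLR
  sdiff_mem : ∀ X ∈ Λ.𝒜, ∀ Y ∈ Λ.𝒜, X \ Y ∈ Λ.𝒜

/-! ## The inverse semigroup `S` -/

/-- The underlying set of the inverse semigroup
`S = {(α,A,β) : α, β ∈ ℒ^*, A ∈ 𝒜^α ∩ 𝒜^β, A ≠ ∅} ∪ {0}`. -/
def SSet : Set (Tr V A) :=
  {t | t = Tr.zero ∨ ∃ α X β, t = Tr.mk α X β ∧ α ∈ Λ.LStar ∧ β ∈ Λ.LStar ∧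
    X ∈ Λ.Aset α ∧ X ∈ Λ.Aset β ∧ X.Nonempty}

/-- The semilattice of idempotents `E(S) = {(α,A,α)} ∪ {0}`. -/
def ESet : Set (Tr V A) :=
  {t | t = Tr.zero ∨ ∃ α X, t = Tr.mk α X α ∧ α ∈ Λ.LStar ∧ X ∈ Λ.Aset α ∧ X.Nonempty}

/-- The product of `S`. -/
noncomputable def tmul : Tr V A → Tr V A → Tr V A
  | Tr.zero, _ => Tr.zero
  | Tr.mk _ _ _, Tr.zero => Tr.zero
  | Tr.mk α X β, Tr.mk γ Y δ =>
    if β <+: γ ∧ (Λ.relRange X (γ.drop β.length) ∩ Y).Nonempty then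
      Tr.mk (α ++ γ.drop β.length) (Λ.relRange X (γ.drop β.length) ∩ Y) δ
    else if γ <+: β ∧ (X ∩ Λ.relRange Y (β.drop γ.length)).Nonempty then
      Tr.mk α (X ∩ Λ.relRange Y (β.drop γ.length)) (δ ++ β.drop γ.length)
    else Tr.zero

/-! ## Filters in `E(S)`, characters, and the tight spectrum -/

/-- A filter in `E(S)`: a nonempty subset of `E(S) ∖ {0}` closed under products and
upward closed in the natural order (`p ≤ q ↔ pq = p`). -/
def IsFilterES (ξ : Set (Tr V A)) : Prop :=
  ξ.Nonempty ∧ (∀ t ∈ ξ, t ∈ Λ.ESet ∧ t ≠ Tr.zero) ∧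
  (∀ p ∈ ξ, ∀ q ∈ ξ, Λ.tmul p q ∈ ξ) ∧
  (∀ p ∈ ξ, ∀ q ∈ Λ.ESet, Λ.tmul p q = p → q ∈ ξ)

/-- An ultrafilter in `E(S)`. -/
def IsUltraES (ξ : Set (Tr V A)) : Prop :=
  Λ.IsFilterES ξ ∧ ∀ ζ, Λ.IsFilterES ζ → ξ ⊆ ζ → ξ = ζ

/-- The character (indicator function) of a filter. -/
noncomputable def charOf (_Λ : LblSp V Ed A) (ξ : Set (Tr V A)) : Tr V A → Bool :=
  fun t => if t ∈ ξ then true else false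

/-- A character of `E(S)`: a nonzero, zero- and meet-preserving `{0,1}`-valued map on
`E(S)` (encoded as a map on triples vanishing outside `E(S)`). -/
def IsChar (φ : Tr V A → Bool) : Prop :=
  (∃ e, φ e = true) ∧ (∀ e, e ∉ Λ.ESet → φ e = false) ∧ φ Tr.zero = false ∧
  ∀ e ∈ Λ.ESet, ∀ f ∈ Λ.ESet, φ (Λ.tmul e f) = (φ e && φ f)

/-- The tight spectrum `Ê_tight`: the closure, within the space of characters with the
topology of pointwise convergence, of the set of characters of ultrafilters. -/
def tightSpectrum : Set (Tr V A → Bool) :=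
  {φ | Λ.IsChar φ} ∩ closure {φ | ∃ ξ, Λ.IsUltraES ξ ∧ φ = Λ.charOf ξ}

/-- A tight filter: a filter whose character lies in the tight spectrum. -/
def IsTightFilter (ξ : Set (Tr V A)) : Prop :=
  Λ.IsFilterES ξ ∧ Λ.charOf ξ ∈ Λ.tightSpectrum

/-- `ξ_{|β|} = {B : (β, B, β) ∈ ξ}`, the filter of `ξ` at level `β`. -/
def filterAt (_Λ : LblSp V Ed A) (ξ : Set (Tr V A)) (β : List A) : Set (Set V) :=
  {B | Tr.mk β B β ∈ ξ}

/-- `α` is the word associated with the filter `ξ` (i.e. `ξ = ξ^α`): the nonempty finite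
beginnings of `α` are exactly the words appearing in elements of `ξ`. -/
def HasWord (_Λ : LblSp V Ed A) (ξ : Set (Tr V A)) (α : Word A) : Prop :=
  ∀ β : List A, β ≠ [] → ((∃ B, Tr.mk β B β ∈ ξ) ↔ WPrefix β α)

/-! ## Filters and ultrafilters in `𝒜^β` -/

/-- A filter in the Boolean algebra `𝒜^β`. -/
def IsFilterAset (β : List A) (F : Set (Set V)) : Prop :=
  F.Nonempty ∧ F ⊆ Λ.Aset β ∧ (∀ X ∈ F, X.Nonempty) ∧
  (∀ X ∈ F, ∀ Y ∈ F, X ∩ Y ∈ F) ∧ (∀ X ∈ F, ∀ Y ∈ Λ.Aset β, X ⊆ Y → Y ∈ F)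

/-- An ultrafilter in `𝒜^β` (an element of `X_β`). -/
def IsUltraAset (β : List A) (F : Set (Set V)) : Prop :=
  Λ.IsFilterAset β F ∧ ∀ G, Λ.IsFilterAset β G → F ⊆ G → F = G

/-- The gluing map `g_{(α)β}(F) = {C ∩ r(αβ) : C ∈ F}` on ultrafilters. -/
noncomputable def gmap (α β : List A) (F : Set (Set V)) : Set (Set V) :=
  {X | ∃ C ∈ F, X = C ∩ Λ.rangeL (α ++ β)}

/-- The cutting map `h_{[α]β}(F) = {C ∈ 𝒜^β : D ⊆ C for some D ∈ F}` on ultrafilters. -/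
noncomputable def hmap (α β : List A) (F : Set (Set V)) : Set (Set V) :=
  {C | C ∈ Λ.Aset β ∧ ∃ D ∈ F, D ⊆ C}

/-! ## Cutting and gluing of (tight) filters in `E(S)` -/

/-- The cutting map `H_{[α]β} : T^{αβ} → T^{(α)β}` (word-free formulation): the filter
whose family is `η_n = h_{[α]β_{1,n}}(ξ_{n+|α|})`; `H_{[ω]β}` is the identity. -/
noncomputable def Hcut (α : List A) (ξ : Set (Tr V A)) : Set (Tr V A) :=
  if α = [] then ξ
  else {t | ∃ δ B, t = Tr.mk δ B δ ∧ B ∈ Λ.Aset δ ∧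
        ∃ D, Tr.mk (α ++ δ) D (α ++ δ) ∈ ξ ∧ D ⊆ B}

/-- The gluing map `G_{(α)β} : T^{(α)β} → T^{αβ}` (word-free formulation): the filter with
family `η_{|α|+n} = g_{(α)β_{1,n}}(ξ_n)` for `n ≥ 1` and `η_i = f_{α_{1,i}[…]}(…)` for
`i ≤ |α|`, with the two cases according to whether the word of `ξ` is empty (`β = ω`)
or not; `G_{(ω)β}` is the identity. -/
noncomputable def Gglue (α : List A) (ξ : Set (Tr V A)) : Set (Tr V A) :=
  if α = [] then ξ
  else if ∃ (δ : List A) (B : Set V), δ ≠ [] ∧ Tr.mk δ B δ ∈ ξ then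
    {t | ∃ δ B, t = Tr.mk δ B δ ∧
      ((α <+: δ ∧ α ≠ δ ∧ ∃ C, Tr.mk (δ.drop α.length) C (δ.drop α.length) ∈ ξ ∧
          B = C ∩ Λ.rangeL δ) ∨
       (δ <+: α ∧ B ∈ Λ.Aset δ ∧ ∃ (b : A) (C : Set V), Tr.mk [b] C [b] ∈ ξ ∧
          Λ.relRange B (α.drop δ.length ++ [b]) = C ∩ Λ.rangeL (α ++ [b])))}
  else
    {t | ∃ δ B, t = Tr.mk δ B δ ∧ δ <+: α ∧ B ∈ Λ.Aset δ ∧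
      ∃ C, Tr.mk [] C [] ∈ ξ ∧ Λ.relRange B (α.drop δ.length) = C ∩ Λ.rangeL α}

/-- `T^β`: the set of tight filters with associated word `β`. -/
def TWord (β : Word A) : Set (Set (Tr V A)) :=
  {ξ | Λ.IsTightFilter ξ ∧ Λ.HasWord ξ β}

/-- `T^{(α)β} = {ξ ∈ T^β : r(α) ∈ ξ_0}` (equal to `T^β` when `α = ω`), the domain of the
gluing map `G_{(α)β}`. -/
def TGlueDom (α : List A) (β : Word A) : Set (Set (Tr V A)) :=
  {ξ | Λ.IsTightFilter ξ ∧ Λ.HasWord ξ β ∧ (α ≠ [] → Tr.mk [] (Λ.rangeL α) [] ∈ ξ)}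

/-! ## The groupoid `Γ` -/

/-- The defining relation of
`Γ = {(ξ^{aγ}, |a|-|b|, η^{bγ}) ∈ T × ℤ × T : H_{[a]γ}(ξ^{aγ}) = H_{[b]γ}(η^{bγ})}`. -/
def InGamma (η : Set (Tr V A)) (m : ℤ) (ξ : Set (Tr V A)) : Prop :=
  ∃ (a b : List A) (γ : Word A), a ∈ Λ.LStar ∧ b ∈ Λ.LStar ∧ Λ.IsWordW γ ∧
    η ∈ Λ.TWord (wappend a γ) ∧ ξ ∈ Λ.TWord (wappend b γ) ∧
    m = (a.length : ℤ) - (b.length : ℤ) ∧ Λ.Hcut a η = Λ.Hcut b ξ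

/-- `Γ` as a set of raw triples. -/
def GammaRaw : Set (Set (Tr V A) × ℤ × Set (Tr V A)) :=
  {p | Λ.InGamma p.1 p.2.1 p.2.2}

/-- The basic set `Z_{s,e:e₁,…,eₙ}` of `Γ` (raw version), for `s = (μ, X, ν)`:
triples `(η^{μγ}, |μ|-|ν|, ξ^{νγ}) ∈ Γ` with `e ∈ ξ`, `eᵢ ∉ ξ` and
`H_{[μ]γ}(η) = H_{[ν]γ}(ξ)`. -/
noncomputable def ZrawGen (μ ν : List A) (e : Tr V A) (es : List (Tr V A)) :
    Set (Set (Tr V A) × ℤ × Set (Tr V A)) :=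
  {p | Λ.InGamma p.1 p.2.1 p.2.2 ∧ p.2.1 = (μ.length : ℤ) - (ν.length : ℤ) ∧
       e ∈ p.2.2 ∧ (∀ f ∈ es, f ∉ p.2.2) ∧
       ∃ γ : Word A, Λ.HasWord p.1 (wappend μ γ) ∧ Λ.HasWord p.2.2 (wappend ν γ) ∧
         Λ.Hcut μ p.1 = Λ.Hcut ν p.2.2}

/-- `Z_s = Z_{s, s*s}` for `s = (μ, X, ν)` (raw version). -/
noncomputable def Zraw (μ : List A) (X : Set V) (ν : List A) :
    Set (Set (Tr V A) × ℤ × Set (Tr V A)) :=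
  Λ.ZrawGen μ ν (Tr.mk ν X ν) []

/-- The basic set `V_{e:e₁,…,eₙ} = U_{e:e₁,…,eₙ} ∩ T` of the tight filter space
(raw version). -/
def VrawGen (e : Tr V A) (es : List (Tr V A)) : Set (Set (Tr V A)) :=
  {ξ | Λ.IsTightFilter ξ ∧ e ∈ ξ ∧ ∀ f ∈ es, f ∉ ξ}

/-- The shift map `σ : T^{(1)} → T`, `σ(ξ^{aγ}) = H_{[a]γ}(ξ^{aγ})` (extended by the
identity off its domain). -/
noncomputable def sigmaMap (ξ : Set (Tr V A)) : Set (Tr V A) :=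
  if h : ∃ a : A, ∃ B : Set V, Tr.mk [a] B [a] ∈ ξ then Λ.Hcut [h.choose] ξ else ξ

/-- The Renault–Deaconu basic set
`𝒱(X, Y, m, n) = {(η, m-n, ξ) ∈ Γ : (η, ξ) ∈ X × Y, σ^m(η) = σ^n(ξ)}` (raw version). -/
noncomputable def VrdRaw (Xs Ys : Set (Set (Tr V A))) (m n : ℕ) :
    Set (Set (Tr V A) × ℤ × Set (Tr V A)) :=
  {p | Λ.InGamma p.1 p.2.1 p.2.2 ∧ p.2.1 = (m : ℤ) - (n : ℤ) ∧
       p.1 ∈ Xs ∧ p.2.2 ∈ Ys ∧ (Λ.sigmaMap)^[m] p.1 = (Λ.sigmaMap)^[n] p.2.2}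

/-! ## The groupoid of germs `𝒢_tight` -/

/-- The action `θ_s(φ)(e) = φ(s* e s)` of `S` on characters. -/
noncomputable def theta (s : Tr V A) (φ : Tr V A → Bool) : Tr V A → Bool :=
  fun e => if e ∈ Λ.ESet then φ (Λ.tmul (Λ.tmul (Tr.tstar s) e) s) else false

/-- `Ω = {(s, φ) ∈ S × Ê_tight : φ ∈ D_{s*s}}`. -/
noncomputable def Omega : Set (Tr V A × (Tr V A → Bool)) :=
  {p | p.1 ∈ Λ.SSet ∧ p.2 ∈ Λ.tightSpectrum ∧ p.2 (Λ.tmul (Tr.tstar p.1) p.1) = true}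

/-- The germ equivalence relation on `Ω`: `(s,φ) ∼ (t,ψ)` iff `φ = ψ` and there is
`e ∈ E(S)` with `φ(e) = 1` and `se = te`. -/
noncomputable def germEquiv (p q : Tr V A × (Tr V A → Bool)) : Prop :=
  p.2 = q.2 ∧ ∃ e ∈ Λ.ESet, p.2 e = true ∧ Λ.tmul p.1 e = Λ.tmul q.1 e

/-- The map `Φ` at the level of `Ω`: for `t = (β, X, γ)` and `φ` with filter `ξ^α`
(where `α = γα'`), `Φ[t,φ] = ((G_{(β)α'} ∘ H_{[γ]α'})(ξ^α), |β|-|γ|, ξ^α)`. -/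
noncomputable def PhiRaw : Tr V A → (Tr V A → Bool) → Set (Tr V A) × ℤ × Set (Tr V A)
  | Tr.zero, _ => (∅, 0, ∅)
  | Tr.mk β _ γ, φ =>
      (Λ.Gglue β (Λ.Hcut γ {e | φ e = true}), (β.length : ℤ) - (γ.length : ℤ),
        {e | φ e = true})

/-! ## Miscellaneous notions -/

/-- `ℒ(XE¹) = {ℒ(e) : e ∈ E¹, s(e) ∈ X}`. -/
def labE (X : Set V) : Set A := {a | ∃ e, Λ.lab e = a ∧ Λ.src e ∈ X}

/-- The set `E⁰_sink` of sinks. -/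
def sinks : Set V := {v | ∀ e, Λ.src e ≠ v}

/-- The filter in `E(S)` associated with a pair (word, complete family). -/
def pairFilter (_Λ : LblSp V Ed A) (α : Word A) (F : ℕ → Set (Set V)) : Set (Tr V A) :=
  {t | ∃ (n : ℕ) (B : Set V), (n : ℕ∞) ≤ wlength α ∧ B ∈ F n ∧
    t = Tr.mk (wprefix α n) B (wprefix α n)}

/-- A complete family for the word `α`: `F n` is a filter in `𝒜^{α_{1,n}}` for
`1 ≤ n ≤ |α|` (`F 0` is a filter in `𝒜` or empty, and a filter if `α = ω`), and
`F n = {X ∈ 𝒜^{α_{1,n}} : r(X, α_{n+1}) ∈ F (n+1)}` for all `n < |α|`. -/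
noncomputable def IsCompleteFamily (α : Word A) (F : ℕ → Set (Set V)) : Prop :=
  Λ.IsWordW α ∧
  (∀ n : ℕ, 1 ≤ n → (n : ℕ∞) ≤ wlength α → Λ.IsFilterAset (wprefix α n) (F n)) ∧
  (F 0 = ∅ ∨ Λ.IsFilterAset [] (F 0)) ∧
  (wlength α = 0 → Λ.IsFilterAset [] (F 0)) ∧
  (∀ n : ℕ, ((n + 1 : ℕ) : ℕ∞) ≤ wlength α →
    F n = {X | X ∈ Λ.Aset (wprefix α n) ∧
      Λ.relRange X ((wprefix α (n + 1)).drop n) ∈ F (n + 1)})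

/-! ## The tight filter space `T` and the groupoid `Γ` as types -/

/-- The space `T` of tight filters. -/
structure TightT where
  carrier : Set (Tr V A)
  tight : Λ.IsTightFilter carrier

/-- The topology of `T`, induced from pointwise convergence of characters. -/
noncomputable instance : TopologicalSpace Λ.TightT :=
  TopologicalSpace.induced (fun ξ => Λ.charOf ξ.carrier) inferInstance

/-- The groupoid `Γ ⊆ T × ℤ × T` as a type. -/
structure GammaT where
  fst : Λ.TightT
  mid : ℤ
  lst : Λ.TightT
  mem : Λ.InGamma fst.carrier mid lst.carrier

/-- The raw triple underlying an element of `Γ`. -/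
def rawOf (p : Λ.GammaT) : Set (Tr V A) × ℤ × Set (Tr V A) :=
  (p.fst.carrier, p.mid, p.lst.carrier)

/-- The collection of all sets `Z_{s,e:e₁,…,eₙ}` (for `s ∈ S`, `e, eᵢ ∈ E(S)`),
as subsets of `Γ`. -/
noncomputable def ZBasisT : Set (Set Λ.GammaT) :=
  {Z | ∃ (μ : List A) (X : Set V) (ν : List A) (e : Tr V A) (es : List (Tr V A)),
    Tr.mk μ X ν ∈ Λ.SSet ∧ e ∈ Λ.ESet ∧ (∀ f ∈ es, f ∈ Λ.ESet) ∧
    Z = {p : Λ.GammaT | Λ.rawOf p ∈ Λ.ZrawGen μ ν e es}}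

/-- The topology on `Γ` induced by the isomorphism `Φ` from the germ topology of
`𝒢_tight`, generated by the images of the basic sets `Θ(s, 𝒰)` with `𝒰 ⊆ D_{s*s}`
open in the tight spectrum. -/
noncomputable def PhiTopology : TopologicalSpace Λ.GammaT :=
  TopologicalSpace.generateFrom
    {Z | ∃ (s : Tr V A) (U : Set (Tr V A → Bool)), s ∈ Λ.SSet ∧
      (∃ W, IsOpen W ∧ U = W ∩ Λ.tightSpectrum) ∧
      (∀ φ ∈ U, φ (Λ.tmul (Tr.tstar s) s) = true) ∧
      Z = {p : Λ.GammaT | ∃ φ ∈ U, (s, φ) ∈ Λ.Omega ∧ Λ.PhiRaw s φ = Λ.rawOf p}}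

end LblSp

namespace LblSp

variable {V : Type u} {Ed : Type v} {A : Type w} (Λ : LblSp V Ed A)


/-! ### Relative ranges -/

/-- The one-letter relative range `r(X, a)`. -/
def stepRange (X : Set V) (a : A) : Set V :=
  {v | ∃ e, Λ.src e ∈ X ∧ Λ.lab e = a ∧ Λ.rng e = v}

theorem relRange_nil (X : Set V) : Λ.relRange X [] = X := by simp [relRange]

theorem relRange_cons (X : Set V) (a : A) (α : List A) :
    Λ.relRange X (a :: α) = Λ.relRange (Λ.stepRange X a) α := by
  ext v
  rcases α with _ | ⟨b, α⟩
  · simp only [relRange, stepRange, if_true, List.cons_ne_nil, if_false, Set.mem_ofPred_eq]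
    constructor
    · rintro ⟨l, hl, -, hm, hs, hr⟩
      rcases l with _ | ⟨e, _ | ⟨f, l⟩⟩
      · exact absurd rfl hl
      · exact ⟨e, hs, by simpa using hm, hr⟩
      · simp at hm
    · rintro ⟨e, hs, ha, hr⟩
      exact ⟨[e], by simp, List.isChain_singleton e, by simp [ha], hs, hr⟩
  · simp only [relRange, stepRange, List.cons_ne_nil, if_false, Set.mem_ofPred_eq]
    constructor
    · rintro ⟨l, hl, hc, hm, hs, hr⟩
      rcases l with _ | ⟨e, _ | ⟨f, l⟩⟩
      · exact absurd rfl hl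
      · simp at hm
      · simp only [List.map_cons, List.cons.injEq] at hm
        have hc := List.isChain_cons_cons.1 hc
        exact ⟨f :: l, by simp, hc.2, by simp [hm.2.1, hm.2.2],
          ⟨e, hs, hm.1, hc.1⟩, by simpa using hr⟩
    · rintro ⟨l, hl, hc, hm, ⟨e, hs, ha, he⟩, hr⟩
      rcases l with _ | ⟨f, l⟩
      · exact absurd rfl hl
      · refine ⟨e :: f :: l, by simp, ?_, by simp [ha, ← hm], hs, by simpa using hr⟩
        exact List.isChain_cons_cons.2 ⟨he, hc⟩

theorem relRange_eq_foldl (X : Set V) (α : List A) :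
    Λ.relRange X α = α.foldl Λ.stepRange X := by
  induction α generalizing X with
  | nil => exact Λ.relRange_nil X
  | cons a α ih => rw [relRange_cons, ih, List.foldl_cons]

theorem relRange_append (X : Set V) (α β : List A) :
    Λ.relRange X (α ++ β) = Λ.relRange (Λ.relRange X α) β := by
  simp only [relRange_eq_foldl, List.foldl_append]

theorem relRange_singleton (X : Set V) (a : A) : Λ.relRange X [a] = Λ.stepRange X a := by
  simp [relRange_eq_foldl]

theorem stepRange_mono {X Y : Set V} (h : X ⊆ Y) (a : A) :
    Λ.stepRange X a ⊆ Λ.stepRange Y a := by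
  rintro v ⟨e, hs, he⟩
  exact ⟨e, h hs, he⟩

theorem relRange_mono {X Y : Set V} (h : X ⊆ Y) (α : List A) :
    Λ.relRange X α ⊆ Λ.relRange Y α := by
  induction α generalizing X Y with
  | nil => simpa [relRange_nil] using h
  | cons a α ih => simpa [relRange_cons] using ih (Λ.stepRange_mono h a)

theorem relRange_union (X Y : Set V) (α : List A) :
    Λ.relRange (X ∪ Y) α = Λ.relRange X α ∪ Λ.relRange Y α := by
  induction α generalizing X Y with
  | nil => simp [relRange_nil]
  | cons a α ih =>
    rw [relRange_cons, relRange_cons, relRange_cons, ← ih]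
    congr 1
    ext v
    simp only [stepRange, Set.mem_union, Set.mem_ofPred_eq]
    grind

theorem relRange_empty (α : List A) : Λ.relRange ∅ α = ∅ := by
  induction α with
  | nil => exact Λ.relRange_nil ∅
  | cons a α ih =>
    rw [relRange_cons]
    convert ih
    ext v
    simp [stepRange]

theorem mem_LStar_of_relRange_nonempty {X : Set V} {α : List A}
    (h : (Λ.relRange X α).Nonempty) : α ∈ Λ.LStar := by
  by_cases hα : α = []
  · exact Or.inl hα
  · obtain ⟨v, hv⟩ := h
    simp only [relRange, hα, if_false, Set.mem_ofPred_eq] at hv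
    obtain ⟨l, hl, hc, hm, -⟩ := hv
    exact Or.inr ⟨l, hl, hc, hm⟩

theorem relRange_subset_rangeL_append {X : Set V} {α : List A} (h : X ⊆ Λ.rangeL α)
    (β : List A) : Λ.relRange X β ⊆ Λ.rangeL (α ++ β) := by
  rw [rangeL, relRange_append]
  exact Λ.relRange_mono h β

theorem mem_labE_of_relRange_cons_nonempty {X : Set V} {a : A} {α : List A}
    (h : (Λ.relRange X (a :: α)).Nonempty) : a ∈ Λ.labE X := by
  by_contra ha
  have : Λ.stepRange X a = ∅ := by
    rw [Set.eq_empty_iff_forall_notMem]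
    rintro v ⟨e, hs, he, -⟩
    exact ha ⟨e, he, hs⟩
  rw [relRange_cons, this, relRange_empty] at h
  exact Set.not_nonempty_empty h

theorem relRange_eq_empty_of_subset_sinks {X : Set V} (h : X ⊆ Λ.sinks) (a : A) (α : List A) :
    Λ.relRange X (a :: α) = ∅ := by
  by_contra hne
  obtain ⟨e, -, he⟩ := Λ.mem_labE_of_relRange_cons_nonempty (Set.nonempty_iff_ne_empty.2 hne)
  exact h he e rfl

section

variable {Λ}

theorem IsNormal.relRange_mem (hΛ : Λ.IsNormal) {X : Set V} (hX : X ∈ Λ.𝒜) (α : List A) :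
    Λ.relRange X α ∈ Λ.𝒜 := by
  rcases Set.eq_empty_or_nonempty (Λ.relRange X α) with h | h
  · rw [h, ← Set.sdiff_self (s := X)]
    exact hΛ.sdiff_mem X hX X hX
  · exact hΛ.toIsWLR.toIsLS.relRange_mem X hX α (Λ.mem_LStar_of_relRange_nonempty h)

theorem IsNormal.inter_mem (hΛ : Λ.IsNormal) {X Y : Set V} (hX : X ∈ Λ.𝒜) (hY : Y ∈ Λ.𝒜) :
    X ∩ Y ∈ Λ.𝒜 :=
  hΛ.toIsWLR.toIsLS.inter_mem X hX Y hY

theorem IsNormal.relRange_inter_subset (hΛ : Λ.IsNormal) {X Y : Set V} (hX : X ∈ Λ.𝒜)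
    (hY : Y ∈ Λ.𝒜) (α : List A) :
    Λ.relRange X α ∩ Λ.relRange Y α ⊆ Λ.relRange (X ∩ Y) α := by
  by_cases hα : α = []
  · simp [hα, relRange_nil]
  · intro v hv
    rwa [hΛ.toIsWLR.wlr X hX Y hY α (Λ.mem_LStar_of_relRange_nonempty ⟨v, hv.1⟩) hα]

/-! ### The semilattice `E(S)` -/

theorem zero_mem_ESet : (Tr.zero : Tr V A) ∈ Λ.ESet := Or.inl rfl

theorem mk_mem_ESet {α : List A} {X : Set V} (hX : X ∈ Λ.Aset α) (hne : X.Nonempty) :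
    Tr.mk α X α ∈ Λ.ESet :=
  Or.inr ⟨α, X, rfl, Λ.mem_LStar_of_relRange_nonempty (hne.mono hX.2), hX, hne⟩

theorem of_mk_mem_ESet {α β : List A} {X : Set V} (h : Tr.mk α X β ∈ Λ.ESet) :
    β = α ∧ X ∈ Λ.Aset α ∧ X.Nonempty := by
  rcases h with h | ⟨γ, Y, h, -, hY, hne⟩
  · cases h
  · cases h
    exact ⟨rfl, hY, hne⟩

theorem zero_tmul (p : Tr V A) : Λ.tmul Tr.zero p = Tr.zero := by
  cases p <;> rfl

theorem tmul_zero (p : Tr V A) : Λ.tmul p Tr.zero = Tr.zero := by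
  cases p <;> rfl

theorem tmul_mk_append (β δ : List A) (B C : Set V) :
    Λ.tmul (Tr.mk β B β) (Tr.mk (β ++ δ) C (β ++ δ)) =
      if (Λ.relRange B δ ∩ C).Nonempty then
        Tr.mk (β ++ δ) (Λ.relRange B δ ∩ C) (β ++ δ) else Tr.zero := by
  by_cases h : (Λ.relRange B δ ∩ C).Nonempty
  · simp [tmul, h]
  · rcases δ with _ | ⟨a, δ⟩
    · simp_all [tmul, relRange_nil]
    · simp only [tmul, List.prefix_append, List.drop_left, h, and_false, if_false, ite_eq_right_iff]
      rintro ⟨h', -⟩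
      have := h'.length_le
      simp at this

theorem tmul_append_mk (β δ : List A) (B C : Set V) :
    Λ.tmul (Tr.mk (β ++ δ) C (β ++ δ)) (Tr.mk β B β) =
      if (C ∩ Λ.relRange B δ).Nonempty then
        Tr.mk (β ++ δ) (C ∩ Λ.relRange B δ) (β ++ δ) else Tr.zero := by
  rcases δ with _ | ⟨a, δ⟩
  · simp [tmul, relRange_nil]
  · have h' : ¬ (β ++ a :: δ <+: β) := fun h' => by
      have := h'.length_le
      simp at this
    simp [tmul, h']

theorem tmul_mk_of_not_prefix {β γ : List A} (h₁ : ¬ β <+: γ) (h₂ : ¬ γ <+: β) (B C : Set V) :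
    Λ.tmul (Tr.mk β B β) (Tr.mk γ C γ) = Tr.zero := by
  simp [tmul, h₁, h₂]

variable (Λ) in
/-- The explicit form of the natural order on `E(S)`. -/
def IdemLe : Tr V A → Tr V A → Prop
  | .zero, _ => True
  | .mk _ _ _, .zero => False
  | .mk β B _, .mk γ C _ => ∃ δ, β = γ ++ δ ∧ B ⊆ Λ.relRange C δ

theorem IdemLe.trans {p q s : Tr V A} (h₁ : Λ.IdemLe p q) (h₂ : Λ.IdemLe q s) :
    Λ.IdemLe p s := by
  cases p <;> cases q <;> cases s <;> simp only [IdemLe] at h₁ h₂ ⊢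
  obtain ⟨δ, rfl, h⟩ := h₁
  obtain ⟨ε, rfl, h'⟩ := h₂
  exact ⟨ε ++ δ, by simp, by
    rw [relRange_append]
    exact h.trans (Λ.relRange_mono h' δ)⟩

theorem tmul_eq_left_iff {p q : Tr V A} (hp : p ∈ Λ.ESet) (hq : q ∈ Λ.ESet) :
    Λ.tmul p q = p ↔ Λ.IdemLe p q := by
  rcases p with _ | ⟨β, B, β'⟩
  · simp [zero_tmul, IdemLe]
  rcases q with _ | ⟨γ, C, γ'⟩
  · simp [tmul_zero, IdemLe]
  obtain ⟨rfl, -, hne⟩ := of_mk_mem_ESet hp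
  obtain ⟨rfl, -, -⟩ := of_mk_mem_ESet hq
  simp only [IdemLe]
  by_cases h₁ : γ' <+: β'
  · obtain ⟨δ, rfl⟩ := h₁
    rw [tmul_append_mk]
    simp only [List.append_cancel_left_eq, exists_eq_left']
    constructor
    · intro h
      split_ifs at h with hn
      simp only [Tr.mk.injEq, true_and, and_true, Set.inter_eq_left] at h
      exact h
    · intro h
      rw [Set.inter_eq_left.2 h, if_pos hne]
  · refine iff_of_false (fun h => ?_) (fun ⟨δ, h, _⟩ => h₁ ⟨δ, h.symm⟩)
    by_cases h₂ : β' <+: γ'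
    · obtain ⟨δ, rfl⟩ := h₂
      rw [tmul_mk_append] at h
      split_ifs at h with hn
      simp only [Tr.mk.injEq] at h
      exact h₁ (by rw [h.1])
    · rw [tmul_mk_of_not_prefix h₂ h₁] at h
      cases h

theorem IsNormal.tmul_isGLB (hΛ : Λ.IsNormal) {p q : Tr V A} (hp : p ∈ Λ.ESet)
    (hq : q ∈ Λ.ESet) :
    Λ.tmul p q ∈ Λ.ESet ∧ Λ.IdemLe (Λ.tmul p q) p ∧ Λ.IdemLe (Λ.tmul p q) q ∧
      ∀ g ∈ Λ.ESet, Λ.IdemLe g p → Λ.IdemLe g q → Λ.IdemLe g (Λ.tmul p q) := by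
  rcases p with _ | ⟨β, B, β'⟩
  · rw [zero_tmul]
    exact ⟨zero_mem_ESet, trivial, trivial, fun g _ h _ => h⟩
  rcases q with _ | ⟨γ, C, γ'⟩
  · rw [tmul_zero]
    exact ⟨zero_mem_ESet, trivial, trivial, fun g _ _ h => h⟩
  obtain ⟨rfl, hB, -⟩ := of_mk_mem_ESet hp
  obtain ⟨rfl, hC, -⟩ := of_mk_mem_ESet hq
  have key : ∀ {X Y : Set V} {δ ε : List A} {G : Set V}, X ∈ Λ.𝒜 → Y ∈ Λ.𝒜 →
      G ⊆ Λ.relRange X (δ ++ ε) → G ⊆ Λ.relRange Y ε →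
      G ⊆ Λ.relRange (Λ.relRange X δ ∩ Y) ε := by
    intro X Y δ ε G hX hY h₁ h₂
    rw [relRange_append] at h₁
    exact (Set.subset_inter h₁ h₂).trans
      (hΛ.relRange_inter_subset (hΛ.relRange_mem hX δ) hY ε)
  by_cases h₁ : γ' <+: β'
  · obtain ⟨δ, rfl⟩ := h₁
    rw [tmul_append_mk]
    have hle : ∀ g ∈ Λ.ESet, Λ.IdemLe g (Tr.mk (γ' ++ δ) B (γ' ++ δ)) →
        Λ.IdemLe g (Tr.mk γ' C γ') →
        Λ.IdemLe g (Tr.mk (γ' ++ δ) (B ∩ Λ.relRange C δ) (γ' ++ δ)) := by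
      rintro (_ | ⟨κ, G, κ'⟩) - hg₁ hg₂
      · trivial
      · obtain ⟨ε, rfl, hε⟩ := hg₁
        obtain ⟨ε', he, hε'⟩ := hg₂
        rw [List.append_assoc, List.append_cancel_left_eq] at he
        subst he
        refine ⟨ε, rfl, ?_⟩
        rw [Set.inter_comm]
        exact key hC.1 hB.1 hε' hε
    split_ifs with hn
    · refine ⟨mk_mem_ESet ⟨hΛ.inter_mem hB.1 (hΛ.relRange_mem hC.1 δ),
        Set.inter_subset_left.trans hB.2⟩ hn, ⟨[], by simp, ?_⟩,
        ⟨δ, rfl, Set.inter_subset_right⟩, hle⟩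
      rw [relRange_nil]
      exact Set.inter_subset_left
    · refine ⟨zero_mem_ESet, trivial, trivial, fun g hg h h' => ?_⟩
      have hg' := hle g hg h h'
      rcases g with _ | ⟨κ, G, κ'⟩
      · trivial
      · obtain ⟨-, -, hne⟩ := of_mk_mem_ESet hg
        obtain ⟨ε, -, hε⟩ := hg'
        rw [Set.not_nonempty_iff_eq_empty.1 hn, relRange_empty] at hε
        exact absurd (hne.mono hε) Set.not_nonempty_empty
  · by_cases h₂ : β' <+: γ'
    · obtain ⟨δ, rfl⟩ := h₂
      rw [tmul_mk_append]
      have hle : ∀ g ∈ Λ.ESet, Λ.IdemLe g (Tr.mk β' B β') →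
          Λ.IdemLe g (Tr.mk (β' ++ δ) C (β' ++ δ)) →
          Λ.IdemLe g (Tr.mk (β' ++ δ) (Λ.relRange B δ ∩ C) (β' ++ δ)) := by
        rintro (_ | ⟨κ, G, κ'⟩) - hg₁ hg₂
        · trivial
        · obtain ⟨ε, rfl, hε⟩ := hg₂
          obtain ⟨ε', he, hε'⟩ := hg₁
          rw [List.append_assoc, List.append_cancel_left_eq] at he
          subst he
          exact ⟨ε, rfl, key hB.1 hC.1 hε' hε⟩
      split_ifs with hn
      · refine ⟨mk_mem_ESet ⟨hΛ.inter_mem (hΛ.relRange_mem hB.1 δ) hC.1,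
          Set.inter_subset_right.trans hC.2⟩ hn, ⟨δ, rfl, Set.inter_subset_left⟩,
          ⟨[], by simp, ?_⟩, hle⟩
        rw [relRange_nil]
        exact Set.inter_subset_right
      · refine ⟨zero_mem_ESet, trivial, trivial, fun g hg h h' => ?_⟩
        have hg' := hle g hg h h'
        rcases g with _ | ⟨κ, G, κ'⟩
        · trivial
        · obtain ⟨-, -, hne⟩ := of_mk_mem_ESet hg
          obtain ⟨ε, -, hε⟩ := hg'
          rw [Set.not_nonempty_iff_eq_empty.1 hn, relRange_empty] at hε
          exact absurd (hne.mono hε) Set.not_nonempty_empty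
    · rw [tmul_mk_of_not_prefix h₂ h₁]
      refine ⟨zero_mem_ESet, trivial, trivial, ?_⟩
      rintro (_ | ⟨κ, G, κ'⟩) - hg₁ hg₂
      · trivial
      · obtain ⟨ε, rfl, -⟩ := hg₁
        obtain ⟨ε', he, -⟩ := hg₂
        rcases List.prefix_or_prefix_of_prefix (List.prefix_append β' ε) ⟨ε', he.symm⟩ with h | h
        · exact absurd h h₂
        · exact absurd h h₁

/-! ### Filters in `E(S)` -/

theorem IsFilterES.exists_eq_mk {η : Set (Tr V A)} (hη : Λ.IsFilterES η) {t : Tr V A}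
    (ht : t ∈ η) : ∃ β B, t = Tr.mk β B β ∧ B ∈ Λ.Aset β ∧ B.Nonempty := by
  obtain ⟨h, h0⟩ := hη.2.1 t ht
  rcases h with h | ⟨β, B, h, -, hB, hne⟩
  · exact absurd h h0
  · exact ⟨β, B, h, hB, hne⟩

theorem IsFilterES.mem_Aset {η : Set (Tr V A)} (hη : Λ.IsFilterES η) {β : List A} {B : Set V}
    (h : Tr.mk β B β ∈ η) : B ∈ Λ.Aset β :=
  (of_mk_mem_ESet (hη.2.1 _ h).1).2.1

theorem IsFilterES.nonempty_of_mem {η : Set (Tr V A)} (hη : Λ.IsFilterES η) {β : List A}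
    {B : Set V} (h : Tr.mk β B β ∈ η) : B.Nonempty :=
  (of_mk_mem_ESet (hη.2.1 _ h).1).2.2

theorem IsFilterES.mem_of_le {η : Set (Tr V A)} (hη : Λ.IsFilterES η) {p q : Tr V A}
    (hp : p ∈ η) (hq : q ∈ Λ.ESet) (h : Λ.IdemLe p q) : q ∈ η :=
  hη.2.2.2 p hp q hq ((tmul_eq_left_iff (hη.2.1 p hp).1 hq).2 h)

theorem IsFilterES.mem_of_append {η : Set (Tr V A)} (hη : Λ.IsFilterES η) {β δ : List A}
    {B C : Set V} (hC : Tr.mk (β ++ δ) C (β ++ δ) ∈ η) (hB : B ∈ Λ.Aset β)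
    (h : C ⊆ Λ.relRange B δ) : Tr.mk β B β ∈ η := by
  refine hη.mem_of_le hC (mk_mem_ESet hB ?_) ⟨δ, rfl, h⟩
  rw [Set.nonempty_iff_ne_empty]
  rintro rfl
  rw [relRange_empty] at h
  exact Set.not_nonempty_empty ((hη.nonempty_of_mem hC).mono h)

theorem IsFilterES.mem_of_subset {η : Set (Tr V A)} (hη : Λ.IsFilterES η) {β : List A}
    {B C : Set V} (hC : Tr.mk β C β ∈ η) (hB : B ∈ Λ.Aset β) (h : C ⊆ B) :
    Tr.mk β B β ∈ η :=
  hη.mem_of_append (δ := []) (C := C) (by simpa using hC) hB (by simpa [relRange_nil] using h)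

theorem IsFilterES.mem_relRange_inter {η : Set (Tr V A)} (hη : Λ.IsFilterES η) {β δ : List A}
    {B C : Set V} (hB : Tr.mk β B β ∈ η) (hC : Tr.mk (β ++ δ) C (β ++ δ) ∈ η) :
    Tr.mk (β ++ δ) (Λ.relRange B δ ∩ C) (β ++ δ) ∈ η := by
  have h := hη.2.2.1 _ hB _ hC
  rw [tmul_mk_append] at h
  split_ifs at h with hn
  · exact h
  · exact absurd rfl (hη.2.1 _ h).2

theorem IsFilterES.mem_inter {η : Set (Tr V A)} (hη : Λ.IsFilterES η) {β : List A}
    {B C : Set V} (hB : Tr.mk β B β ∈ η) (hC : Tr.mk β C β ∈ η) :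
    Tr.mk β (B ∩ C) β ∈ η := by
  simpa [relRange_nil] using hη.mem_relRange_inter (δ := []) (C := C) hB (by simpa using hC)

theorem IsFilterES.prefix_or_prefix {η : Set (Tr V A)} (hη : Λ.IsFilterES η) {β γ : List A}
    {B C : Set V} (hB : Tr.mk β B β ∈ η) (hC : Tr.mk γ C γ ∈ η) : β <+: γ ∨ γ <+: β := by
  by_contra! h
  have h' := hη.2.2.1 _ hB _ hC
  rw [tmul_mk_of_not_prefix h.1 h.2] at h'
  exact (hη.2.1 _ h').2 rfl

theorem IsFilterES.isFilterAset {η : Set (Tr V A)} (hη : Λ.IsFilterES η) {β : List A}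
    (h : (Λ.filterAt η β).Nonempty) : Λ.IsFilterAset β (Λ.filterAt η β) :=
  ⟨h, fun _ hX => hη.mem_Aset hX, fun _ hX => hη.nonempty_of_mem hX,
    fun _ hX _ hY => hη.mem_inter hX hY, fun _ hX _ hY hXY => hη.mem_of_subset hX hY hXY⟩

theorem IdemLe.refl {p : Tr V A} : Λ.IdemLe p p := by
  rcases p with _ | ⟨β, B, β'⟩
  · trivial
  · exact ⟨[], by simp, by rw [relRange_nil]⟩

/-- The upward closure of a downward directed set of nonzero idempotents is a filter. -/
theorem IsNormal.isFilterES_up (hΛ : Λ.IsNormal) (D : Set (Tr V A)) (hne : D.Nonempty)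
    (hD : ∀ d ∈ D, d ∈ Λ.ESet ∧ d ≠ Tr.zero)
    (hdir : ∀ d ∈ D, ∀ d' ∈ D, ∃ c ∈ D, Λ.IdemLe c d ∧ Λ.IdemLe c d') :
    Λ.IsFilterES {q | q ∈ Λ.ESet ∧ ∃ d ∈ D, Λ.IdemLe d q} := by
  refine ⟨?_, ?_, ?_, ?_⟩
  · obtain ⟨d, hd⟩ := hne
    exact ⟨d, (hD d hd).1, d, hd, .refl⟩
  · rintro q ⟨hq, d, hd, hdq⟩
    refine ⟨hq, ?_⟩
    rintro rfl
    rcases d with _ | ⟨β, B, β'⟩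
    · exact (hD _ hd).2 rfl
    · exact hdq
  · rintro p ⟨hp, d, hd, hdp⟩ q ⟨hq, d', hd', hdq⟩
    obtain ⟨c, hc, hcd, hcd'⟩ := hdir d hd d' hd'
    obtain ⟨hmem, -, -, hglb⟩ := hΛ.tmul_isGLB hp hq
    exact ⟨hmem, c, hc, hglb c (hD c hc).1 (hcd.trans hdp) (hcd'.trans hdq)⟩
  · rintro p ⟨hp, d, hd, hdp⟩ q hq hpq
    exact ⟨hq, d, hd, hdp.trans ((tmul_eq_left_iff hp hq).1 hpq)⟩

theorem IsUltraES.exists_tmul_eq_zero (hΛ : Λ.IsNormal) {η : Set (Tr V A)}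
    (hη : Λ.IsUltraES η) {e : Tr V A} (he : e ∈ Λ.ESet) (heη : e ∉ η) :
    ∃ g ∈ η, Λ.tmul g e = Tr.zero := by
  by_contra! h
  obtain ⟨g₀, hg₀⟩ := hη.1.1
  have hglb : ∀ g ∈ η, _ := fun g hg => hΛ.tmul_isGLB (hη.1.2.1 g hg).1 he
  have hζ : Λ.IsFilterES {q | q ∈ Λ.ESet ∧ ∃ d ∈ (fun g => Λ.tmul g e) '' η, Λ.IdemLe d q} := by
    refine hΛ.isFilterES_up _ ⟨_, g₀, hg₀, rfl⟩ ?_ ?_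
    · rintro _ ⟨g, hg, rfl⟩
      exact ⟨(hglb g hg).1, h g hg⟩
    · rintro _ ⟨g, hg, rfl⟩ _ ⟨g', hg', rfl⟩
      have hm := hη.1.2.2.1 g hg g' hg'
      obtain ⟨-, h₁, h₂, -⟩ := hΛ.tmul_isGLB (hη.1.2.1 g hg).1 (hη.1.2.1 g' hg').1
      obtain ⟨h₀, h₃, h₄, -⟩ := hglb _ hm
      exact ⟨_, ⟨_, hm, rfl⟩, (hglb g hg).2.2.2 _ h₀ (h₃.trans h₁) h₄,
        (hglb g' hg').2.2.2 _ h₀ (h₃.trans h₂) h₄⟩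
  have heq := hη.2 _ hζ fun g hg => ⟨(hη.1.2.1 g hg).1, _, ⟨g, hg, rfl⟩, (hglb g hg).2.1⟩
  refine heη ?_
  rw [heq]
  exact ⟨he, _, ⟨g₀, hg₀, rfl⟩, (hglb g₀ hg₀).2.2.1⟩

theorem IsNormal.exists_isUltraES_mem (hΛ : Λ.IsNormal) {β : List A} {B : Set V}
    (hB : B ∈ Λ.Aset β) (hne : B.Nonempty) : ∃ η, Λ.IsUltraES η ∧ Tr.mk β B β ∈ η := by
  have he := mk_mem_ESet hB hne
  have hup : Λ.IsFilterES {q | q ∈ Λ.ESet ∧ ∃ d ∈ ({Tr.mk β B β} : Set (Tr V A)),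
      Λ.IdemLe d q} := by
    refine hΛ.isFilterES_up _ (Set.singleton_nonempty _) ?_ ?_
    · rintro _ rfl
      exact ⟨he, by simp⟩
    · rintro _ rfl _ rfl
      exact ⟨_, rfl, .refl, .refl⟩
  obtain ⟨η, hle, hmax⟩ := zorn_subset_nonempty {η | Λ.IsFilterES η} (by
    intro c hc hchain hcne
    refine ⟨⋃₀ c, ⟨?_, ?_, ?_, ?_⟩, fun s hs => Set.subset_sUnion_of_mem hs⟩
    · obtain ⟨s, hs⟩ := hcne
      exact (hc hs).1.mono (Set.subset_sUnion_of_mem hs)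
    · rintro t ⟨s, hs, ht⟩
      exact (hc hs).2.1 t ht
    · rintro p ⟨s, hs, hp⟩ q ⟨s', hs', hq⟩
      rcases hchain.total hs hs' with h | h
      · exact ⟨s', hs', (hc hs').2.2.1 p (h hp) q hq⟩
      · exact ⟨s, hs, (hc hs).2.2.1 p hp q (h hq)⟩
    · rintro p ⟨s, hs, hp⟩ q hq hpq
      exact ⟨s, hs, (hc hs).2.2.2 p hp q hq hpq⟩) _ hup
  exact ⟨η, ⟨hmax.prop, fun ζ hζ h => hmax.eq_of_subset hζ h⟩, hle ⟨he, _, rfl, .refl⟩⟩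

/-! ### Ultrafilters in `𝒜^β` -/

theorem IsUltraAset.exists_inter_eq_empty (hΛ : Λ.IsNormal) {β : List A} {F : Set (Set V)}
    (hF : Λ.IsUltraAset β F) {D : Set V} (hD : D ∈ Λ.Aset β) (hDF : D ∉ F) :
    ∃ X ∈ F, X ∩ D = ∅ := by
  by_contra! h
  obtain ⟨⟨hne, hsub, -, hinter, -⟩, hmax⟩ := hF
  obtain ⟨X₀, hX₀⟩ := hne
  have hG : Λ.IsFilterAset β {Y | Y ∈ Λ.Aset β ∧ ∃ X ∈ F, X ∩ D ⊆ Y} := by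
    refine ⟨⟨D, hD, X₀, hX₀, Set.inter_subset_right⟩, fun Y hY => hY.1, ?_, ?_, ?_⟩
    · rintro Y ⟨-, X, hX, hXY⟩
      exact (h X hX).mono hXY
    · rintro Y ⟨hY, X, hX, hXY⟩ Y' ⟨hY', X', hX', hXY'⟩
      refine ⟨⟨hΛ.inter_mem hY.1 hY'.1, Set.inter_subset_left.trans hY.2⟩, X ∩ X',
        hinter X hX X' hX', ?_⟩
      exact fun v hv => ⟨hXY ⟨hv.1.1, hv.2⟩, hXY' ⟨hv.1.2, hv.2⟩⟩
    · rintro Y ⟨-, X, hX, hXY⟩ Z hZ hYZ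
      exact ⟨hZ, X, hX, hXY.trans hYZ⟩
  have heq := hmax _ hG fun Y hY => ⟨hsub hY, Y, hY, Set.inter_subset_left⟩
  refine hDF ?_
  rw [heq]
  exact ⟨hD, X₀, hX₀, Set.inter_subset_right⟩

theorem IsFilterAset.exists_of_not_isUltraAset {β : List A} {F : Set (Set V)}
    (hF : Λ.IsFilterAset β F) (hu : ¬ Λ.IsUltraAset β F) :
    ∃ D ∈ Λ.Aset β, D ∉ F ∧ ∀ X ∈ F, (X ∩ D).Nonempty := by
  simp only [IsUltraAset, hF, true_and, not_forall] at hu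
  obtain ⟨G, hG, hFG, hne⟩ := hu
  obtain ⟨D, hD, hDF⟩ := Set.not_subset.1 fun h => hne (hFG.antisymm h)
  exact ⟨D, hG.2.1 hD, hDF, fun X hX => hG.2.2.1 _ (hG.2.2.2.1 X (hFG hX) D hD)⟩

/-! ### Tight filters -/

theorem mem_closure_pi_bool_iff {ι : Type*} {S : Set (ι → Bool)} {φ : ι → Bool} :
    φ ∈ closure S ↔ ∀ I : Finset ι, ∃ ψ ∈ S, ∀ i ∈ I, ψ i = φ i := by
  rw [mem_closure_iff]
  constructor
  · intro h I
    obtain ⟨ψ, hψ, hS⟩ := h ((I : Set ι).pi fun i => {φ i})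
      (isOpen_set_pi I.finite_toSet fun i _ => isOpen_discrete _) (by simp)
    exact ⟨ψ, hS, by simpa using hψ⟩
  · intro h o ho hφ
    obtain ⟨I, u, hu, hI⟩ := isOpen_pi_iff.1 ho φ hφ
    obtain ⟨ψ, hψ, hψI⟩ := h I
    refine ⟨ψ, hI fun i hi => ?_, hψ⟩
    rw [hψI i hi]
    exact (hu i hi).2

theorem IsFilterES.isChar_charOf (hΛ : Λ.IsNormal) {ξ : Set (Tr V A)} (hξ : Λ.IsFilterES ξ) :
    Λ.IsChar (Λ.charOf ξ) := by
  refine ⟨?_, ?_, ?_, ?_⟩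
  · obtain ⟨e, he⟩ := hξ.1
    exact ⟨e, by simp [charOf, he]⟩
  · intro e he
    simpa [charOf] using fun h => he (hξ.2.1 e h).1
  · simpa [charOf] using fun h => (hξ.2.1 _ h).2 rfl
  · intro e he f hf
    obtain ⟨-, h₁, h₂, -⟩ := hΛ.tmul_isGLB he hf
    have : Λ.tmul e f ∈ ξ ↔ e ∈ ξ ∧ f ∈ ξ :=
      ⟨fun h => ⟨hξ.mem_of_le h he h₁, hξ.mem_of_le h hf h₂⟩, fun h => hξ.2.2.1 e h.1 f h.2⟩
    simp [charOf, this]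

theorem IsFilterES.isTightFilter_iff (hΛ : Λ.IsNormal) {ξ : Set (Tr V A)}
    (hξ : Λ.IsFilterES ξ) :
    Λ.IsTightFilter ξ ↔
      ∀ I : Finset (Tr V A), ∃ η, Λ.IsUltraES η ∧ ∀ i ∈ I, (i ∈ η ↔ i ∈ ξ) := by
  have hchar : ∀ (η : Set (Tr V A)) i, Λ.charOf η i = Λ.charOf ξ i ↔ (i ∈ η ↔ i ∈ ξ) := by
    intro η i
    by_cases h₁ : i ∈ η <;> by_cases h₂ : i ∈ ξ <;> simp [charOf, h₁, h₂]
  have hmem : Λ.IsTightFilter ξ ↔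
      Λ.charOf ξ ∈ closure {φ | ∃ η, Λ.IsUltraES η ∧ φ = Λ.charOf η} :=
    ⟨fun h => h.2.2, fun h => ⟨hξ, hξ.isChar_charOf hΛ, h⟩⟩
  rw [hmem, mem_closure_pi_bool_iff]
  constructor
  · intro h I
    obtain ⟨_, ⟨η, hη, rfl⟩, hI⟩ := h I
    exact ⟨η, hη, fun i hi => (hchar η i).1 (hI i hi)⟩
  · intro h I
    obtain ⟨η, hη, hI⟩ := h I
    exact ⟨_, ⟨η, hη, rfl⟩, fun i hi => (hchar η i).2 (hI i hi)⟩

theorem IsUltraES.isTightFilter (hΛ : Λ.IsNormal) {ξ : Set (Tr V A)} (hξ : Λ.IsUltraES ξ) :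
    Λ.IsTightFilter ξ :=
  (hξ.1.isTightFilter_iff hΛ).2 fun _ => ⟨ξ, hξ, fun _ _ => Iff.rfl⟩

/-- Finitely many idempotents outside an ultrafilter are all annihilated by a single element of
the ultrafilter, which may be taken below a prescribed one. -/
theorem IsUltraES.exists_disjoint (hΛ : Λ.IsNormal) {η : Set (Tr V A)} (hη : Λ.IsUltraES η)
    {β : List A} {X : Set V} (hX : Tr.mk β X β ∈ η) (J : Finset (Tr V A))
    (hJ : ∀ e ∈ J, e ∈ Λ.ESet ∧ e ∉ η) :
    ∃ δ C, Tr.mk (β ++ δ) C (β ++ δ) ∈ η ∧ C ⊆ Λ.relRange X δ ∧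
      ∀ e ∈ J, Λ.tmul (Tr.mk (β ++ δ) C (β ++ δ)) e = Tr.zero := by
  have hmain : ∃ g ∈ η, Λ.IdemLe g (Tr.mk β X β) ∧ ∀ e ∈ J, Λ.tmul g e = Tr.zero := by
    induction J using Finset.induction_on with
    | empty => exact ⟨_, hX, .refl, by simp⟩
    | insert e J _ ih =>
      obtain ⟨g, hg, hgX, hgJ⟩ := ih fun e he => hJ e (Finset.mem_insert_of_mem he)
      obtain ⟨he, heη⟩ := hJ e (Finset.mem_insert_self e J)
      obtain ⟨f, hf, hfe⟩ := hη.exists_tmul_eq_zero hΛ he heη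
      have hgE := (hη.1.2.1 g hg).1
      have hfE := (hη.1.2.1 f hf).1
      obtain ⟨hgf, h₁, h₂, -⟩ := hΛ.tmul_isGLB hgE hfE
      have hzero : ∀ {p q d : Tr V A}, p ∈ Λ.ESet → q ∈ Λ.ESet → d ∈ Λ.ESet → Λ.IdemLe p q →
          Λ.tmul q d = Tr.zero → Λ.tmul p d = Tr.zero := by
        intro p q d hp hq hd hpq h
        obtain ⟨hpd, h₃, h₄, -⟩ := hΛ.tmul_isGLB hp hd
        have h₅ := (hΛ.tmul_isGLB hq hd).2.2.2 _ hpd (h₃.trans hpq) h₄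
        rw [h] at h₅
        generalize Λ.tmul p d = t at h₅
        rcases t with _ | ⟨_, _, _⟩
        · rfl
        · exact h₅.elim
      refine ⟨_, hη.1.2.2.1 g hg f hf, h₁.trans hgX, fun d hd => ?_⟩
      rcases Finset.mem_insert.1 hd with rfl | hdJ
      · exact hzero hgf hfE he h₂ hfe
      · exact hzero hgf hgE (hJ d hd).1 h₁ (hgJ d hdJ)
  obtain ⟨g, hg, hgX, hgJ⟩ := hmain
  obtain ⟨γ, C, rfl, -, -⟩ := hη.1.exists_eq_mk hg
  obtain ⟨δ, rfl, hC⟩ := hgX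
  exact ⟨δ, C, hg, hC, hgJ⟩

theorem IsTightFilter.isUltraAset (hΛ : Λ.IsNormal) {ξ : Set (Tr V A)}
    (hξ : Λ.IsTightFilter ξ) {β : List A} (hne : (Λ.filterAt ξ β).Nonempty) :
    Λ.IsUltraAset β (Λ.filterAt ξ β) := by
  by_contra hu
  have hF := hξ.1.isFilterAset hne
  obtain ⟨D, hD, hDξ, hmeet⟩ := hF.exists_of_not_isUltraAset hu
  obtain ⟨X, hX⟩ := hne
  have hXA := hF.2.1 hX
  have hsub₁ : X ∩ D ∉ Λ.filterAt ξ β := fun h =>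
    hDξ (hF.2.2.2.2 _ h D hD Set.inter_subset_right)
  have hsub₂ : X \ D ∉ Λ.filterAt ξ β := fun h => by
    obtain ⟨v, hv, hv'⟩ := hmeet _ h
    exact hv.2 hv'
  obtain ⟨η, hη, hI⟩ := (hξ.1.isTightFilter_iff hΛ).1 hξ
    {Tr.mk β X β, Tr.mk β (X ∩ D) β, Tr.mk β (X \ D) β}
  have hXη : Tr.mk β X β ∈ η := (hI _ (by simp)).2 hX
  have hdiff : X \ D ∈ Λ.Aset β :=
    ⟨hΛ.sdiff_mem X hXA.1 D hD.1, Set.sdiff_subset.trans hXA.2⟩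
  have hinter : X ∩ D ∈ Λ.Aset β := ⟨hΛ.inter_mem hXA.1 hD.1, Set.inter_subset_left.trans hXA.2⟩
  have h₁ : Tr.mk β (X ∩ D) β ∉ η := fun h => hsub₁ ((hI _ (by simp)).1 h)
  have h₂ : Tr.mk β (X \ D) β ∉ η := fun h => hsub₂ ((hI _ (by simp)).1 h)
  have hnd : (X \ D).Nonempty := by
    rw [Set.nonempty_iff_ne_empty]
    intro h
    rw [Set.sdiff_eq_empty] at h
    exact hDξ (hF.2.2.2.2 _ hX D hD h)
  obtain ⟨δ, C, hC, hCX, hJ⟩ := hη.exists_disjoint hΛ hXη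
    {Tr.mk β (X ∩ D) β, Tr.mk β (X \ D) β} (by
      intro e he
      simp only [Finset.mem_insert, Finset.mem_singleton] at he
      rcases he with rfl | rfl
      · exact ⟨mk_mem_ESet hinter (hmeet X hX), h₁⟩
      · exact ⟨mk_mem_ESet hdiff hnd, h₂⟩)
  have hz₁ := hJ (Tr.mk β (X ∩ D) β) (by simp)
  have hz₂ := hJ (Tr.mk β (X \ D) β) (by simp)
  rw [tmul_append_mk] at hz₁ hz₂
  obtain ⟨v, hv⟩ := hη.1.nonempty_of_mem hC
  have hv' := hCX hv
  rw [← Set.inter_union_sdiff X D, relRange_union] at hv'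
  rcases hv' with hv' | hv'
  · rw [if_pos ⟨v, hv, hv'⟩] at hz₁
    cases hz₁
  · rw [if_pos ⟨v, hv, hv'⟩] at hz₂
    cases hz₂

theorem IsTightFilter.infinite_or_exists_sinks (hΛ : Λ.IsNormal) {ξ : Set (Tr V A)}
    (hξ : Λ.IsTightFilter ξ) {l : List A} (hl : ∀ a B, Tr.mk (l ++ [a]) B (l ++ [a]) ∉ ξ)
    {X : Set V} (hX : Tr.mk l X l ∈ ξ) :
    (Λ.labE X).Infinite ∨ ∃ B ∈ Λ.Aset l, B.Nonempty ∧ B ⊆ X ∩ Λ.sinks := by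
  rw [or_iff_not_imp_left, Set.not_infinite]
  intro hfin
  let e : A → Tr V A := fun a => Tr.mk (l ++ [a]) (Λ.relRange X [a]) (l ++ [a])
  obtain ⟨η, hη, hI⟩ := (hξ.1.isTightFilter_iff hΛ).1 hξ
    (insert (Tr.mk l X l) (hfin.toFinset.image e))
  have hXη : Tr.mk l X l ∈ η := (hI _ (by simp)).2 hX
  have hXA := hξ.1.mem_Aset hX
  obtain ⟨δ, C, hC, hCX, hJ⟩ := hη.exists_disjoint hΛ hXη (hfin.toFinset.image e) (by
    intro f hf
    have hf' := hI f (Finset.mem_insert_of_mem hf)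
    obtain ⟨a, ha, rfl⟩ := Finset.mem_image.1 hf
    obtain ⟨d, hd, hs⟩ := hfin.mem_toFinset.1 ha
    refine ⟨mk_mem_ESet ⟨hΛ.relRange_mem hXA.1 _, Λ.relRange_subset_rangeL_append hXA.2 _⟩ ?_,
      fun h => hl _ _ (hf'.1 h)⟩
    rw [relRange_singleton]
    exact ⟨Λ.rng d, d, hs, hd, rfl⟩)
  have hCne := hη.1.nonempty_of_mem hC
  rcases δ with _ | ⟨a, δ⟩
  · rw [relRange_nil] at hCX
    rw [List.append_nil] at hC hJ
    refine ⟨C, hη.1.mem_Aset hC, hCne, fun v hv => ⟨hCX hv, fun d hd => ?_⟩⟩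
    have h := hJ (e (Λ.lab d)) (Finset.mem_image_of_mem e
      (hfin.mem_toFinset.2 ⟨d, rfl, by rw [hd]; exact hCX hv⟩))
    simp only [e] at h
    rw [tmul_mk_append, relRange_singleton, relRange_singleton, if_pos] at h
    · cases h
    · exact ⟨Λ.rng d, ⟨d, by rwa [hd], rfl, rfl⟩, ⟨d, by rw [hd]; exact hCX hv, rfl, rfl⟩⟩
  · have h := hJ (e a) (Finset.mem_image_of_mem e
      (hfin.mem_toFinset.2 (Λ.mem_labE_of_relRange_cons_nonempty (hCne.mono hCX))))
    have happ : l ++ a :: δ = (l ++ [a]) ++ δ := by simp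
    simp only [e] at h
    rw [happ, tmul_append_mk, ← relRange_append, if_pos] at h
    · cases h
    · rw [List.singleton_append, Set.inter_eq_left.2 hCX]
      exact hCne

theorem HasWord.prefix_of_mem {ξ : Set (Tr V A)} {l : List A} (hw : Λ.HasWord ξ (Sum.inl l))
    {β : List A} {B : Set V} (h : Tr.mk β B β ∈ ξ) : β <+: l := by
  by_cases hβ : β = []
  · simp [hβ]
  · exact (hw β hβ).1 ⟨B, h⟩

/-- For a filter whose word `l` is finite and whose top level is an ultrafilter, membership
of a given element in a filter is decided at level `l`, unless the word of the element
properly extends `l`. -/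
theorem HasWord.exists_decides (hΛ : Λ.IsNormal) {ξ : Set (Tr V A)} (hξ : Λ.IsFilterES ξ)
    {l : List A} (hw : Λ.HasWord ξ (Sum.inl l)) (hu : Λ.IsUltraAset l (Λ.filterAt ξ l))
    (i : Tr V A) :
    ∃ X, Tr.mk l X l ∈ ξ ∧
      ((∀ η, Λ.IsFilterES η → Tr.mk l X l ∈ η → (i ∈ η ↔ i ∈ ξ)) ∨
        i ∉ ξ ∧ ∃ a γ B, i = Tr.mk (l ++ a :: γ) B (l ++ a :: γ)) := by
  obtain ⟨X₀, hX₀⟩ := hu.1.1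
  by_cases hi : i ∈ ξ
  · obtain ⟨β, B, rfl, hB, -⟩ := hξ.exists_eq_mk hi
    obtain ⟨δ, rfl⟩ := hw.prefix_of_mem hi
    exact ⟨_, hξ.mem_relRange_inter hi hX₀, Or.inl fun η hη h =>
      iff_of_true (hη.mem_of_append h hB Set.inter_subset_left) hi⟩
  by_cases hE : ∃ β B, i = Tr.mk β B β ∧ B ∈ Λ.Aset β ∧ B.Nonempty
  · obtain ⟨β, B, rfl, hB, -⟩ := hE
    by_cases h₁ : β <+: l
    · obtain ⟨δ, rfl⟩ := h₁
      obtain ⟨X, hX, hXB⟩ := hu.exists_inter_eq_empty hΛ (D := Λ.relRange B δ)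
        ⟨hΛ.relRange_mem hB.1 δ, Λ.relRange_subset_rangeL_append hB.2 δ⟩
        fun h => hi (hξ.mem_of_append h hB subset_rfl)
      refine ⟨X, hX, Or.inl fun η hη h => iff_of_false (fun h' => ?_) hi⟩
      have := hη.nonempty_of_mem (hη.mem_relRange_inter h' h)
      rw [Set.inter_comm, hXB] at this
      exact Set.not_nonempty_empty this
    · by_cases h₂ : l <+: β
      · obtain ⟨_ | ⟨a, γ⟩, rfl⟩ := h₂
        · simp at h₁
        · exact ⟨X₀, hX₀, Or.inr ⟨hi, a, γ, B, rfl⟩⟩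
      · refine ⟨X₀, hX₀, Or.inl fun η hη h => iff_of_false (fun h' => ?_) hi⟩
        exact (hη.prefix_or_prefix h h').elim h₂ h₁
  · exact ⟨X₀, hX₀, Or.inl fun η hη _ => iff_of_false (fun h' => hE (hη.exists_eq_mk h')) hi⟩

theorem HasWord.isTightFilter_of_finite (hΛ : Λ.IsNormal) {ξ : Set (Tr V A)}
    (hξ : Λ.IsFilterES ξ) {l : List A} (hw : Λ.HasWord ξ (Sum.inl l))
    (hu : Λ.IsUltraAset l (Λ.filterAt ξ l))
    (hX : ∀ X ∈ Λ.filterAt ξ l, (Λ.labE X).Infinite ∨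
      ∃ B ∈ Λ.Aset l, B.Nonempty ∧ B ⊆ X ∩ Λ.sinks) :
    Λ.IsTightFilter ξ := by
  rw [hξ.isTightFilter_iff hΛ]
  intro I
  have hdec : ∃ X, Tr.mk l X l ∈ ξ ∧ ∀ i ∈ I,
      (∀ η, Λ.IsFilterES η → Tr.mk l X l ∈ η → (i ∈ η ↔ i ∈ ξ)) ∨
        i ∉ ξ ∧ ∃ a γ B, i = Tr.mk (l ++ a :: γ) B (l ++ a :: γ) := by
    induction I using Finset.induction_on with
    | empty =>
      obtain ⟨X, hX⟩ := hu.1.1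
      exact ⟨X, hX, by simp⟩
    | insert i I _ ih =>
      obtain ⟨X, hX, hXI⟩ := ih
      obtain ⟨Y, hY, hYi⟩ := hw.exists_decides hΛ hξ hu i
      have hXA := hξ.mem_Aset hX
      have hYA := hξ.mem_Aset hY
      refine ⟨X ∩ Y, hξ.mem_inter hX hY, fun j hj => ?_⟩
      rcases Finset.mem_insert.1 hj with rfl | hj
      · exact hYi.imp_left fun h η hη hm =>
          h η hη (hη.mem_of_subset hm hYA Set.inter_subset_right)
      · exact (hXI j hj).imp_left fun h η hη hm =>
          h η hη (hη.mem_of_subset hm hXA Set.inter_subset_left)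
  obtain ⟨X, hXξ, hdec⟩ := hdec
  have hXA := hξ.mem_Aset hXξ
  rcases hX X hXξ with hinf | ⟨B, hB, hBne, hBX⟩
  · have hfin : (⋃ i ∈ I, {a | ∃ γ B, i = Tr.mk (l ++ a :: γ) B (l ++ a :: γ)}).Finite := by
      refine I.finite_toSet.biUnion fun i _ => Set.Subsingleton.finite ?_
      rintro a ⟨γ, B, rfl⟩ b ⟨γ', B', h⟩
      simp only [Tr.mk.injEq, List.append_cancel_left_eq, List.cons.injEq] at h
      exact h.1.1
    obtain ⟨a, ⟨d, hd, hs⟩, ha⟩ := hinf.exists_notMem_finite hfin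
    obtain ⟨η, hη, haη⟩ := hΛ.exists_isUltraES_mem
      ⟨hΛ.relRange_mem hXA.1 [a], Λ.relRange_subset_rangeL_append hXA.2 [a]⟩
      (by rw [relRange_singleton]; exact ⟨Λ.rng d, d, hs, hd, rfl⟩)
    refine ⟨η, hη, fun i hi => ?_⟩
    rcases hdec i hi with h | ⟨hiξ, b, γ, B, rfl⟩
    · exact h η hη.1 (hη.1.mem_of_append haη hXA subset_rfl)
    · refine iff_of_false (fun h => ha ?_) hiξ
      have hab : a = b := by
        rcases hη.1.prefix_or_prefix haη h with h' | h'
        · simpa using h'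
        · have := (List.prefix_append_right_inj l).1 h'
          simp at this
          exact this.1.symm
      subst hab
      exact Set.mem_biUnion hi ⟨γ, B, rfl⟩
  · obtain ⟨η, hη, hBη⟩ := hΛ.exists_isUltraES_mem hB hBne
    refine ⟨η, hη, fun i hi => ?_⟩
    rcases hdec i hi with h | ⟨hiξ, b, γ, C, rfl⟩
    · exact h η hη.1 (hη.1.mem_of_subset hBη hXA (hBX.trans Set.inter_subset_left))
    · refine iff_of_false (fun h => ?_) hiξ
      have := hη.1.nonempty_of_mem (hη.1.mem_relRange_inter hBη h)
      rw [Λ.relRange_eq_empty_of_subset_sinks (hBX.trans Set.inter_subset_right),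
        Set.empty_inter] at this
      exact Set.not_nonempty_empty this

theorem wPrefix_inr_wprefix (f : ℕ → A) (n : ℕ) :
    WPrefix (wprefix (Sum.inr f) n) (Sum.inr f) := by
  simp only [WPrefix, wprefix, Sum.elim_inr]
  apply List.ext_getElem <;> simp

theorem HasWord.isUltraES_of_infinite {ξ : Set (Tr V A)} (hξ : Λ.IsFilterES ξ)
    {f : ℕ → A} (hw : Λ.HasWord ξ (Sum.inr f))
    (hu : ∀ n : ℕ, (Λ.filterAt ξ (wprefix (Sum.inr f) n)).Nonempty →
      Λ.IsUltraAset (wprefix (Sum.inr f) n) (Λ.filterAt ξ (wprefix (Sum.inr f) n))) :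
    Λ.IsUltraES ξ := by
  have hlen : ∀ n, (wprefix (Sum.inr f) n : List A).length = n := by simp [wprefix]
  refine ⟨hξ, fun ζ hζ hle => hle.antisymm fun t ht => ?_⟩
  obtain ⟨β, B, rfl, hB, -⟩ := hζ.exists_eq_mk ht
  have hne : wprefix (Sum.inr f) (β.length + 1) ≠ [] := fun h => by
    have := hlen (β.length + 1)
    simp [h] at this
  obtain ⟨C, hC⟩ := (hw _ hne).2 (wPrefix_inr_wprefix f _)
  have hpre : β <+: wprefix (Sum.inr f) (β.length + 1) := by
    rcases hζ.prefix_or_prefix ht (hle hC) with h | h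
    · exact h
    · have := h.length_le
      rw [hlen] at this
      omega
  have hult := hu (β.length + 1) ⟨C, hC⟩
  generalize wprefix (Sum.inr f) (β.length + 1) = κ at hC hpre hult
  obtain ⟨δ, rfl⟩ := hpre
  have hm := hζ.mem_relRange_inter ht (hle hC)
  have heq := hult.2 _ (hζ.isFilterAset ⟨_, hm⟩) fun Y hY => hle hY
  refine hξ.mem_of_append (C := Λ.relRange B δ ∩ C) ?_ hB Set.inter_subset_left
  have hm' : Λ.relRange B δ ∩ C ∈ Λ.filterAt ζ (β ++ δ) := hm
  rwa [← heq] at hm'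

end

/-- A filter `ξ^α` in `E(S)` with complete family `{ξ_n}` is tight iff
either (i) `α` is infinite and every nonempty member of the family is an ultrafilter, or
(ii) `α` is finite, `ξ_{|α|}` is an ultrafilter in `𝒜^α`, and for every `X ∈ ξ_{|α|}`
either `ℒ(XE¹)` is infinite or there is `B ∈ 𝒜^α` with `∅ ≠ B ⊆ X ∩ E⁰_sink`. -/
theorem statement_17 (hΛ : Λ.IsNormal) (ξ : Set (Tr V A)) (hξ : Λ.IsFilterES ξ)
    (α : Word A) (hw : Λ.HasWord ξ α) :
    Λ.IsTightFilter ξ ↔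
      ((wlength α = ⊤ ∧ ∀ n : ℕ, (Λ.filterAt ξ (wprefix α n)).Nonempty →
          Λ.IsUltraAset (wprefix α n) (Λ.filterAt ξ (wprefix α n))) ∨
       (∃ l : List A, α = Sum.inl l ∧ Λ.IsUltraAset l (Λ.filterAt ξ l) ∧
          ∀ X ∈ Λ.filterAt ξ l, (Λ.labE X).Infinite ∨
            ∃ B ∈ Λ.Aset l, B.Nonempty ∧ B ⊆ X ∩ Λ.sinks)) := by
  constructor
  · intro ht
    rcases α with l | f
    · have hne : (Λ.filterAt ξ l).Nonempty := by
        by_cases hl : l = []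
        · obtain ⟨t, ht⟩ := hξ.1
          obtain ⟨β, B, rfl, -⟩ := hξ.exists_eq_mk ht
          have := hw.prefix_of_mem ht
          rw [hl, List.prefix_nil] at this
          subst this hl
          exact ⟨B, ht⟩
        · exact (hw l hl).2 (List.prefix_refl l)
      refine Or.inr ⟨l, rfl, ht.isUltraAset hΛ hne, fun X hX =>
        ht.infinite_or_exists_sinks hΛ (fun a B h => ?_) hX⟩
      have := (hw.prefix_of_mem h).length_le
      simp at this
    · exact Or.inl ⟨rfl, fun n hn => ht.isUltraAset hΛ hn⟩
  · rintro (⟨htop, hu⟩ | ⟨l, rfl, hu, hX⟩)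
    · rcases α with l | f
      · exact absurd htop (ENat.natCast_ne_top l.length)
      · exact (hw.isUltraES_of_infinite hξ hu).isTightFilter hΛ
    · exact hw.isTightFilter_of_finite hΛ hξ hu hX

end LblSp
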